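/- arXiv:1901.05192 — 7 statements merged into one kernel-verified Lean document; each statement's English description precedes it below -/
import Mathlib

section
/- Let a > 0 and let n ≥ 1 be an integer. Let f ∈ C^{2n+1}([0,a], ℂ) and let g ∈ C^{2n+1}([0,a], ℝ) satisfy g'(x) ≠ 0 for all x ∈ [0,a]. Then there exists a constant c > 0 such that for every real number w with |w| > 1 there exists a function q ∈ C^n([0,a], ℂ) satisfying the ODE q'(x) + i·w·g'(x)·q(x) = f(x) for all x ∈ [0,a], and such that sup_{x∈[0,a]} |q^{(j)}(x)| ≤ c/|w| for every integer j with 0 ≤ j ≤ n. -/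
open Set

/-- The derivatives of a `C^N` function up to order `N` are uniformly bounded on a compact set. -/
theorem exists_iteratedDerivWithin_bound {s : Set ℝ} (hs : UniqueDiffOn ℝ s) (hc : IsCompact s)
    {p : ℝ → ℂ} {N : ℕ} (hp : ContDiffOn ℝ N p s) :
    ∃ B : ℝ, 0 ≤ B ∧ ∀ j ≤ N, ∀ x ∈ s, ‖iteratedDerivWithin j p s x‖ ≤ B := by
  have h : ∀ j : ℕ, ∃ C : ℝ, j ≤ N → ∀ x ∈ s, ‖iteratedDerivWithin j p s x‖ ≤ C := by
    intro j
    by_cases hj : j ≤ N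
    · obtain ⟨C, hC⟩ := hc.exists_bound_of_continuousOn
        (hp.continuousOn_iteratedDerivWithin (by exact_mod_cast hj) hs)
      exact ⟨C, fun _ => hC⟩
    · exact ⟨0, fun h => absurd h hj⟩
  choose C hC using h
  refine ⟨∑ j ∈ Finset.range (N + 1), |C j|, by positivity, fun j hj x hx => ?_⟩
  calc ‖iteratedDerivWithin j p s x‖ ≤ |C j| := (hC j hj x hx).trans (le_abs_self _)
    _ ≤ _ := Finset.single_le_sum (f := fun j => |C j|) (fun _ _ => abs_nonneg _)
        (Finset.mem_range.2 (by omega))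

/-- The solution of `v' + i w g' v = h` with `v 0 = 0` is bounded uniformly in `w`. -/
theorem exists_bounded_solution {a : ℝ} (ha : 0 < a) {g : ℝ → ℝ} {G : ℝ → ℝ}
    (hg : ∀ x ∈ Icc 0 a, HasDerivWithinAt g (G x) (Icc 0 a) x)
    {h : ℝ → ℂ} (hh : ContinuousOn h (Icc 0 a)) {M : ℝ} (hM : ∀ x ∈ Icc 0 a, ‖h x‖ ≤ M) (w : ℝ) :
    ∃ v : ℝ → ℂ,
      (∀ x ∈ Icc 0 a,
        HasDerivWithinAt v (h x - Complex.I * w * G x * v x) (Icc 0 a) x) ∧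
      ∀ x ∈ Icc 0 a, ‖v x‖ ≤ M * a := by
  have hgc : ContinuousOn g (Icc 0 a) := fun x hx => (hg x hx).continuousWithinAt
  set ψ : ℝ → ℂ := fun t => Complex.exp ((w * g t : ℝ) * Complex.I) * h t with hψ
  have hψc : ContinuousOn ψ (Icc 0 a) := by
    refine ContinuousOn.mul (ContinuousOn.cexp (ContinuousOn.mul ?_ continuousOn_const)) hh
    exact Complex.continuous_ofReal.comp_continuousOn (continuousOn_const.mul hgc)
  set φ : ℝ → ℂ := IccExtend ha.le ((Icc 0 a).domRestrict ψ) with hφ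
  have hφc : Continuous φ := (continuousOn_iff_continuous_domRestrict.1 hψc).Icc_extend'
  have hφψ : ∀ x ∈ Icc 0 a, φ x = ψ x := fun x hx => by
    rw [hφ, IccExtend_of_mem _ _ hx, domRestrict_apply]
  have hM' : ∀ x ∈ Icc 0 a, ‖φ x‖ ≤ M := fun x hx => by
    rw [hφψ x hx, hψ]
    simpa only [norm_mul, Complex.norm_exp_ofReal_mul_I, one_mul] using hM x hx
  have hM0 : 0 ≤ M := (norm_nonneg _).trans (hM 0 (left_mem_Icc.2 ha.le))
  refine ⟨fun x => Complex.exp ((-(w * g x) : ℝ) * Complex.I) * ∫ t in (0 : ℝ)..x, φ t,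
    fun x hx => ?_, fun x hx => ?_⟩
  · have h1 : HasDerivWithinAt (fun x => ∫ t in (0 : ℝ)..x, φ t) (φ x) (Icc 0 a) x :=
      (hφc.integral_hasStrictDerivAt 0 x).hasDerivAt.hasDerivWithinAt
    have h2 : HasDerivWithinAt (fun x => ((-(w * g x) : ℝ) : ℂ) * Complex.I)
        (((-(w * G x) : ℝ) : ℂ) * Complex.I) (Icc 0 a) x :=
      (((hg x hx).const_mul w).neg.ofReal_comp).mul_const Complex.I
    refine (h2.cexp.mul h1).congr_deriv ?_
    have h3 : Complex.exp ((-(w * g x) : ℝ) * Complex.I) *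
        Complex.exp ((w * g x : ℝ) * Complex.I) = 1 := by
      rw [← Complex.exp_add, Complex.ofReal_neg, neg_mul, neg_add_cancel, Complex.exp_zero]
    rw [hφψ x hx, hψ]
    push_cast at h3 ⊢
    linear_combination h x * h3
  · rw [norm_mul, Complex.norm_exp_ofReal_mul_I, one_mul]
    refine (intervalIntegral.norm_integral_le_of_norm_le_const (C := M) fun t ht => ?_).trans ?_
    · rw [uIoc_of_le hx.1] at ht
      exact hM' t ⟨ht.1.le, ht.2.trans hx.2⟩
    · rw [sub_zero, abs_of_nonneg hx.1]
      exact mul_le_mul_of_nonneg_left hx.2 hM0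

/-- Solutions of `v' + b v = h` with `h, b` of class `C^m` are of class `C^(m+1)`. -/
theorem contDiffOn_succ_of_linear_ode {s : Set ℝ} (hs : UniqueDiffOn ℝ s) {h b v : ℝ → ℂ} {m : ℕ}
    (hh : ContDiffOn ℝ m h s) (hb : ContDiffOn ℝ m b s)
    (hv : ∀ x ∈ s, HasDerivWithinAt v (h x - b x * v x) s x) :
    ContDiffOn ℝ (m + 1) v s := by
  have step : ∀ k : ℕ, k ≤ m → ContDiffOn ℝ k v s → ContDiffOn ℝ (k + 1) v s := by
    intro k hk hvk
    have hk' : (k : WithTop ℕ∞) ≤ m := by exact_mod_cast hk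
    refine (contDiffOn_succ_iff_derivWithin hs).2
      ⟨fun x hx => (hv x hx).differentiableWithinAt, by simp, ?_⟩
    exact ((hh.of_le hk').sub ((hb.of_le hk').mul hvk)).congr
      fun x hx => (hv x hx).derivWithin (hs x hx)
  have main : ∀ k : ℕ, k ≤ m → ContDiffOn ℝ (k + 1) v s := by
    intro k
    induction k with
    | zero =>
      intro _
      exact step 0 (Nat.zero_le _) <| contDiffOn_zero.2 fun x hx => (hv x hx).continuousWithinAt
    | succ k ih =>
      intro hk
      exact step (k + 1) hk (by exact_mod_cast ih (by omega))
  exact main m le_rfl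

/-- Each derivative of a bounded solution of `v' + i w G v = h` costs at most one power of `|w|`,
with a constant independent of `w` and `v`. -/
theorem exists_iteratedDerivWithin_solution_bound {s : Set ℝ} (hs : UniqueDiffOn ℝ s)
    (hc : IsCompact s) {h G : ℝ → ℂ} {m : ℕ}
    (hh : ContDiffOn ℝ m h s) (hG : ContDiffOn ℝ m G s) {C : ℝ} (hC : 0 ≤ C) (k : ℕ)
    (hk : k ≤ m + 1) :
    ∃ K : ℝ, 0 ≤ K ∧ ∀ w : ℝ, 1 < |w| → ∀ v : ℝ → ℂ,
      (∀ x ∈ s, HasDerivWithinAt v (h x - Complex.I * w * G x * v x) s x) →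
      (∀ x ∈ s, ‖v x‖ ≤ C) →
      ∀ j ≤ k, ∀ x ∈ s, ‖iteratedDerivWithin j v s x‖ ≤ K * |w| ^ j := by
  obtain ⟨Bh, hBh0, hBh⟩ := exists_iteratedDerivWithin_bound hs hc hh
  obtain ⟨BG, hBG0, hBG⟩ := exists_iteratedDerivWithin_bound hs hc hG
  induction k with
  | zero =>
    refine ⟨C, hC, fun w _ v _ hv j hj x hx => ?_⟩
    obtain rfl : j = 0 := by omega
    simpa using hv x hx
  | succ k ih =>
    obtain ⟨K, hK0, hK⟩ := ih (by omega)
    have hkm : k ≤ m := by omega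
    set S : ℝ := ∑ i ∈ Finset.range (k + 1), (k.choose i : ℝ) * BG * K with hS
    have hS0 : 0 ≤ S := Finset.sum_nonneg fun i _ => by positivity
    refine ⟨K + (Bh + S), by positivity, fun w hw v hv hvC j hj x hx => ?_⟩
    have hw0 : 0 ≤ |w| := abs_nonneg w
    have hj' : j ≤ k ∨ j = k + 1 := by omega
    rcases hj' with hj' | rfl
    · refine (hK w hw v hv hvC j hj' x hx).trans ?_
      gcongr
      linarith
    have hb : ContDiffOn ℝ m (fun x => Complex.I * w * G x) s := contDiffOn_const.mul hG
    have hvm : ContDiffOn ℝ m v s :=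
      (contDiffOn_succ_of_linear_ode hs hh hb hv).of_le (by exact_mod_cast Nat.le_succ m)
    have hkm' : (k : WithTop ℕ∞) ≤ m := by exact_mod_cast hkm
    have hGv : ContDiffOn ℝ m (fun x => G x * v x) s := hG.mul hvm
    have hderiv : EqOn (derivWithin v s)
        (h - fun x => Complex.I * w * (G x * v x)) s := fun y hy => by
      rw [(hv y hy).derivWithin (hs y hy), Pi.sub_apply, mul_assoc]
    have hprod : ‖iteratedDerivWithin k (fun x => G x * v x) s x‖ ≤ S * |w| ^ k := by
      rw [← norm_iteratedFDerivWithin_eq_norm_iteratedDerivWithin]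
      refine (norm_iteratedFDerivWithin_mul_le hG hvm hs hx hkm').trans ?_
      rw [hS, Finset.sum_mul]
      refine Finset.sum_le_sum fun i hi => ?_
      have hi' : i ≤ k := by simpa [Nat.lt_succ_iff] using hi
      simp only [norm_iteratedFDerivWithin_eq_norm_iteratedDerivWithin]
      have h1 := hBG i (hi'.trans hkm) x hx
      have h2 : ‖iteratedDerivWithin (k - i) v s x‖ ≤ K * |w| ^ k :=
        (hK w hw v hv hvC (k - i) (Nat.sub_le _ _) x hx).trans <|
          mul_le_mul_of_nonneg_left (pow_le_pow_right₀ hw.le (Nat.sub_le _ _)) hK0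
      rw [mul_assoc _ K]
      gcongr
    rw [iteratedDerivWithin_succ', iteratedDerivWithin_congr hderiv hx,
      iteratedDerivWithin_sub hx hs ((hh x hx).of_le hkm')
        (((contDiffOn_const.mul hGv) x hx).of_le hkm'),
      iteratedDerivWithin_const_mul_field]
    have hpow : 1 ≤ |w| ^ (k + 1) := one_le_pow₀ hw.le
    calc _ ≤ ‖iteratedDerivWithin k h s x‖
          + ‖Complex.I * w * iteratedDerivWithin k (fun x => G x * v x) s x‖ := norm_sub_le _ _
      _ ≤ Bh + |w| * (S * |w| ^ k) := by
        rw [norm_mul, norm_mul, Complex.norm_I, one_mul, Complex.norm_real, Real.norm_eq_abs]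
        gcongr
        exact hBh k hkm x hx
      _ = Bh * 1 + S * |w| ^ (k + 1) := by ring
      _ ≤ Bh * |w| ^ (k + 1) + S * |w| ^ (k + 1) := by gcongr
      _ ≤ (K + (Bh + S)) * |w| ^ (k + 1) := by nlinarith [mul_nonneg hK0 (zero_le_one.trans hpow)]

/-- Each additional derivative of the right-hand side gains one power of `|w|` in the
derivative bounds for a suitable solution of `q' + i w g' q = f`. -/
theorem exists_solution_with_decay {a : ℝ} (ha : 0 < a) {g G : ℝ → ℝ} {m : ℕ}
    (hg : ∀ x ∈ Icc 0 a, HasDerivWithinAt g (G x) (Icc 0 a) x)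
    (hG : ContDiffOn ℝ (2 * m + 2 : ℕ) (fun x => (G x : ℂ)) (Icc 0 a))
    (hG0 : ∀ x ∈ Icc 0 a, G x ≠ 0) (k : ℕ) (hk : k ≤ m + 2) (f : ℝ → ℂ)
    (hf : ContDiffOn ℝ (m + k : ℕ) f (Icc 0 a)) :
    ∃ c : ℝ, 0 ≤ c ∧ ∀ w : ℝ, 1 < |w| → ∃ q : ℝ → ℂ,
      (∀ x ∈ Icc 0 a, HasDerivWithinAt q (f x - Complex.I * w * G x * q x) (Icc 0 a) x) ∧
      ∀ j ≤ m + 1, ∀ x ∈ Icc 0 a,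
        ‖iteratedDerivWithin j q (Icc 0 a) x‖ * |w| ^ k ≤ c * |w| ^ (m + 1) := by
  have hs : UniqueDiffOn ℝ (Icc 0 a) := uniqueDiffOn_Icc ha
  induction k generalizing f with
  | zero =>
    have hGm : ContDiffOn ℝ m (fun x => (G x : ℂ)) (Icc 0 a) :=
      hG.of_le (by exact_mod_cast (by omega : m ≤ 2 * m + 2))
    obtain ⟨M, hM0, hM⟩ := exists_iteratedDerivWithin_bound hs isCompact_Icc hf
    obtain ⟨K, hK0, hK⟩ := exists_iteratedDerivWithin_solution_bound hs isCompact_Icc hf hGm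
      (mul_nonneg hM0 ha.le) (m + 1) le_rfl
    refine ⟨K, hK0, fun w hw => ?_⟩
    obtain ⟨v, hv, hvC⟩ := exists_bounded_solution ha hg hf.continuousOn
      (fun x hx => by simpa using hM 0 (Nat.zero_le _) x hx) w
    refine ⟨v, hv, fun j hj x hx => ?_⟩
    rw [pow_zero, mul_one]
    exact (hK w hw v hv hvC j hj x hx).trans <|
      mul_le_mul_of_nonneg_left (pow_le_pow_right₀ hw.le hj) hK0
  | succ k ih =>
    set p : ℝ → ℂ := fun x => f x / (Complex.I * G x) with hp
    have hpC : ContDiffOn ℝ (m + k + 1 : ℕ) p (Icc 0 a) := by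
      have hGk : ContDiffOn ℝ (m + k + 1 : ℕ) (fun x => (G x : ℂ)) (Icc 0 a) :=
        hG.of_le (by exact_mod_cast (by omega : m + k + 1 ≤ 2 * m + 2))
      simp only [hp, div_eq_mul_inv]
      refine ContDiffOn.mul hf (ContDiffOn.inv (contDiffOn_const.mul hGk) fun x hx => ?_)
      exact mul_ne_zero Complex.I_ne_zero (Complex.ofReal_ne_zero.2 (hG0 x hx))
    have hp' := (contDiffOn_succ_iff_derivWithin hs (n := (m + k : ℕ))).1 (by exact_mod_cast hpC)
    obtain ⟨c, hc0, hc⟩ := ih (by omega) (fun x => -derivWithin p (Icc 0 a) x) hp'.2.2.neg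
    obtain ⟨B, hB0, hB⟩ := exists_iteratedDerivWithin_bound hs isCompact_Icc
      (hpC.of_le (by exact_mod_cast (by omega : m + 1 ≤ m + k + 1)) :
        ContDiffOn ℝ (m + 1 : ℕ) p (Icc 0 a))
    refine ⟨B + c, by positivity, fun w hw => ?_⟩
    obtain ⟨q, hq, hqb⟩ := hc w hw
    have hw0 : 0 < |w| := zero_lt_one.trans hw
    have hwC : (w : ℂ) ≠ 0 := Complex.ofReal_ne_zero.2 (abs_pos.1 hw0)
    have hqC : ContDiffOn ℝ (m + 1) q (Icc 0 a) :=
      contDiffOn_succ_of_linear_ode hs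
        (hp'.2.2.neg.of_le (by exact_mod_cast (by omega : m ≤ m + k)))
        (contDiffOn_const.mul (hG.of_le (by exact_mod_cast (by omega : m ≤ 2 * m + 2)))) hq
    refine ⟨fun x => (w : ℂ)⁻¹ * (p x + q x), fun x hx => ?_, fun j hj x hx => ?_⟩
    · refine (((hp'.1 x hx).hasDerivWithinAt.add (hq x hx)).const_mul (w : ℂ)⁻¹).congr_deriv ?_
      have hGx : (G x : ℂ) ≠ 0 := Complex.ofReal_ne_zero.2 (hG0 x hx)
      have hfp : f x = Complex.I * G x * p x := by
        rw [hp]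
        field_simp [Complex.I_ne_zero]
      rw [hfp]
      field_simp
      ring
    · have hjk : (j : WithTop ℕ∞) ≤ (m + k + 1 : ℕ) := by
        exact_mod_cast (by omega : j ≤ m + k + 1)
      rw [iteratedDerivWithin_const_mul_field, iteratedDerivWithin_fun_add hx hs
        ((hpC x hx).of_le hjk) ((hqC x hx).of_le (by exact_mod_cast hj)), norm_mul, norm_inv,
        Complex.norm_real, Real.norm_eq_abs]
      set P := iteratedDerivWithin j p (Icc 0 a) x
      set Q := iteratedDerivWithin j q (Icc 0 a) x
      calc |w|⁻¹ * ‖P + Q‖ * |w| ^ (k + 1) = ‖P + Q‖ * |w| ^ k := by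
            rw [pow_succ]
            field_simp
        _ ≤ (‖P‖ + ‖Q‖) * |w| ^ k := by gcongr; exact norm_add_le _ _
        _ = ‖P‖ * |w| ^ k + ‖Q‖ * |w| ^ k := by ring
        _ ≤ B * |w| ^ (m + 1) + c * |w| ^ (m + 1) := by
          refine add_le_add ?_ (hqb j hj x hx)
          exact mul_le_mul (hB j hj x hx) (pow_le_pow_right₀ hw.le (by omega)) (by positivity) hB0
        _ = (B + c) * |w| ^ (m + 1) := by ring

/-- Lemma 1 (existence of a non-oscillatory solution of the Levin ODE):
if `f, g ∈ C^{2n+1}([0,a])` and `g' ≠ 0` on `[0,a]`, then there is a constant `c`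
independent of `w` such that for every `|w| > 1` there is a solution `q ∈ Cⁿ([0,a],ℂ)`
of `q' + i w g' q = f` with `‖q^{(j)}‖_∞ ≤ c/|w|` for `0 ≤ j ≤ n`. -/
theorem stmt_3 (a : ℝ) (ha : 0 < a) (n : ℕ) (hn : 1 ≤ n)
    (f : ℝ → ℂ) (g : ℝ → ℝ)
    (hf : ContDiffOn ℝ (2 * n + 1) f (Icc 0 a))
    (hg : ContDiffOn ℝ (2 * n + 1) g (Icc 0 a))
    (hg' : ∀ x ∈ Icc 0 a, derivWithin g (Icc 0 a) x ≠ 0) :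
    ∃ c > 0, ∀ w : ℝ, 1 < |w| →
      ∃ q : ℝ → ℂ, ContDiffOn ℝ n q (Icc 0 a) ∧
        (∀ x ∈ Icc 0 a,
          derivWithin q (Icc 0 a) x
            + Complex.I * w * (derivWithin g (Icc 0 a) x) * q x = f x) ∧
        (∀ j : ℕ, j ≤ n → ∀ x ∈ Icc 0 a,
          ‖iteratedDerivWithin j q (Icc 0 a) x‖ ≤ c / |w|) := by
  obtain ⟨m, rfl⟩ : ∃ m, n = m + 1 := ⟨n - 1, by omega⟩
  have hs : UniqueDiffOn ℝ (Icc 0 a) := uniqueDiffOn_Icc ha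
  have hf' : ContDiffOn ℝ (m + (m + 2) : ℕ) f (Icc 0 a) :=
    hf.of_le (by exact_mod_cast (by omega : m + (m + 2) ≤ 2 * (m + 1) + 1))
  have hgd := (contDiffOn_succ_iff_derivWithin hs (n := (2 * m + 2 : ℕ))).1
    (by exact_mod_cast hg)
  have hG : ContDiffOn ℝ (2 * m + 2 : ℕ)
      (fun x => ((derivWithin g (Icc 0 a) x : ℝ) : ℂ)) (Icc 0 a) :=
    Complex.ofRealCLM.contDiff.comp_contDiffOn hgd.2.2
  obtain ⟨c, hc0, hc⟩ := exists_solution_with_decay ha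
    (fun x hx => (hgd.1 x hx).hasDerivWithinAt) hG hg' (m + 2) le_rfl f hf'
  refine ⟨c + 1, by positivity, fun w hw => ?_⟩
  obtain ⟨q, hq, hqb⟩ := hc w hw
  refine ⟨q, ?_, fun x hx => ?_, fun j hj x hx => ?_⟩
  · have := contDiffOn_succ_of_linear_ode hs (m := m)
      (hf'.of_le (by exact_mod_cast (by omega : m ≤ m + (m + 2))))
      (contDiffOn_const.mul (hG.of_le (by exact_mod_cast (by omega : m ≤ 2 * m + 2)))) hq
    exact_mod_cast this
  · rw [(hq x hx).derivWithin (hs x hx), sub_add_cancel]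
  · have hw0 : 0 < |w| := zero_lt_one.trans hw
    rw [le_div_iff₀ hw0]
    have h1 := hqb j hj x hx
    rw [pow_succ' _ (m + 1), ← mul_assoc] at h1
    linarith [le_of_mul_le_mul_right h1 (by positivity)]
end

section
/- For every real number w and every x ≥ 0, the function t ↦ (1 - e^{iwt})/t (extended by its limit value -iw at t = 0) is integrable on (0, x] and ∫_0^x (1 - e^{iwt})/t dt = - Σ_{j=1}^{∞} (iwx)^j / (j · j!), the series converging absolutely. -/
open Set MeasureTheory

/-- For every `w ∈ ℝ` and `x ≥ 0`, `t ↦ (1 - e^{iwt})/t` is integrable on `(0,x]` and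
`∫_0^x (1 - e^{iwt})/t dt = - ∑_{j=1}^∞ (iwx)^j/(j·j!)`, the series converging absolutely. -/
theorem stmt_4 (w : ℝ) (x : ℝ) (hx : 0 ≤ x) :
    IntegrableOn (fun t : ℝ => (1 - Complex.exp (Complex.I * w * t)) / (t : ℂ))
      (Ioc 0 x) volume ∧
    Summable (fun j : ℕ =>
      ‖(Complex.I * w * x) ^ (j + 1) / ((j + 1 : ℂ) * (Nat.factorial (j + 1) : ℂ))‖) ∧
    ∫ t in Ioc 0 x, (1 - Complex.exp (Complex.I * w * t)) / (t : ℂ)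
      = - ∑' j : ℕ, (Complex.I * w * x) ^ (j + 1) / ((j + 1 : ℂ) * (Nat.factorial (j + 1) : ℂ)) := by
  have hnorm (t : ℝ) : ‖1 - Complex.exp (Complex.I * w * t)‖ ≤ |w| * |t| := by
    have h := Real.norm_exp_I_mul_ofReal_sub_one_le (x := w * t)
    rw [norm_sub_rev]
    simpa [mul_assoc, abs_mul] using h
  have hint : IntegrableOn (fun t : ℝ => (1 - Complex.exp (Complex.I * w * t)) / (t : ℂ))
      (Ioc 0 x) volume := by
    refine Measure.integrableOn_of_bounded (M := |w|) (by simp) ?_ ?_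
    · exact Measurable.aestronglyMeasurable (by fun_prop)
    · refine (ae_restrict_iff' measurableSet_Ioc).2 (Filter.Eventually.of_forall fun t ht => ?_)
      rw [norm_div, Complex.norm_real, Real.norm_eq_abs, div_le_iff₀ (abs_pos.2 ht.1.ne')]
      exact hnorm t
  refine ⟨hint, ?_, ?_⟩
  · refine Summable.of_nonneg_of_le (fun _ => norm_nonneg _) (fun j => ?_)
      ((summable_nat_add_iff 1).2 (Real.summable_pow_div_factorial (|w| * |x|)))
    have hj : ‖(j + 1 : ℂ)‖ = j + 1 := by
      rw [← Nat.cast_succ, Complex.norm_natCast, Nat.cast_succ]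
    simp only [norm_div, norm_mul, norm_pow, Complex.norm_I, one_mul, Complex.norm_real,
      Real.norm_eq_abs, Complex.norm_natCast, hj]
    gcongr
    exact le_mul_of_one_le_left (by positivity) (by simp)
  · have hsum := intervalIntegral.hasSum_integral_of_dominated_convergence (μ := volume)
      (a := 0) (b := x)
      (F := fun (j : ℕ) (t : ℝ) =>
        -((Complex.I * w) ^ (j + 1) / ((j + 1).factorial : ℂ)) * (t : ℂ) ^ j)
      (f := fun t : ℝ => (1 - Complex.exp (Complex.I * w * t)) / (t : ℂ))
      (fun j _ => |w| * ((|w| * x) ^ j / j.factorial))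
      (fun j => Continuous.aestronglyMeasurable (by fun_prop))
      (fun j => Filter.Eventually.of_forall fun t ht => ?_)
      (Filter.Eventually.of_forall fun _ _ =>
        (Real.summable_pow_div_factorial (|w| * x)).mul_left _)
      intervalIntegrable_const
      (Filter.Eventually.of_forall fun t ht => ?_)
    · rw [← intervalIntegral.integral_of_le hx, ← hsum.tsum_eq, ← tsum_neg]
      refine tsum_congr fun j => ?_
      have hpow : ∫ t in (0 : ℝ)..x, (t : ℂ) ^ j = (x : ℂ) ^ (j + 1) / (j + 1) := by
        have h := integral_pow (a := 0) (b := x) j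
        simp_rw [← Complex.ofReal_pow]
        rw [intervalIntegral.integral_ofReal, h]
        simp
      rw [intervalIntegral.integral_const_mul, hpow]
      have : (j + 1 : ℂ) ≠ 0 := Nat.cast_add_one_ne_zero j
      have : ((j + 1).factorial : ℂ) ≠ 0 := Nat.cast_ne_zero.2 (Nat.factorial_ne_zero _)
      rw [mul_pow _ (x : ℂ)]
      field_simp
    · rw [uIoc_of_le hx] at ht
      simp only [norm_neg, norm_div, norm_mul, norm_pow, Complex.norm_I, one_mul,
        Complex.norm_real, Real.norm_eq_abs, Complex.norm_natCast, abs_of_pos ht.1]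
      calc |w| ^ (j + 1) / ((j + 1).factorial : ℝ) * t ^ j
          ≤ |w| ^ (j + 1) / (j.factorial : ℝ) * x ^ j := by
            have := ht.1.le
            gcongr
            · exact j.le_succ
            · exact ht.2
        _ = |w| * ((|w| * x) ^ j / j.factorial) := by ring
    · rw [uIoc_of_le hx] at ht
      have ht0 : (t : ℂ) ≠ 0 := Complex.ofReal_ne_zero.2 ht.1.ne'
      have h := (hasSum_nat_add_iff' 1).2
        (NormedSpace.expSeries_div_hasSum_exp (Complex.I * w * t))
      rw [← Complex.exp_eq_exp_ℂ] at h
      rw [Finset.sum_range_one, pow_zero, Nat.factorial_zero, Nat.cast_one, div_one] at h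
      have hdiv := h.neg.div_const (t : ℂ)
      rw [neg_sub] at hdiv
      refine hdiv.congr_fun fun j => ?_
      rw [mul_pow _ (t : ℂ)]
      field_simp
      ring
end

section
/- Let a > 0, let w ∈ ℝ, let g ∈ C^1([0,a], ℝ), and let f : [0,a] → ℂ be continuous. Suppose q ∈ C^1([0,a], ℂ) satisfies q(0) = 0 and q'(x) + i·w·g'(x)·q(x) = f(x) for all x ∈ [0,a], and suppose h : [0,a] → ℂ is continuous on [0,a], differentiable on (0,a], and satisfies h'(x) + i·w·g'(x)·h(x) = - q(x)/x for all x ∈ (0,a]. Then the function x ↦ f(x)·log(x)·e^{iwg(x)} is integrable on (0,a] and ∫_0^a f(x) log(x) e^{iwg(x)} dx = (q(a)·log(a) + h(a))·e^{iwg(a)} − h(0)·e^{iwg(0)}. -/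
open Set MeasureTheory

/-- A function vanishing at `0` and differentiable there within `s` beats the logarithm. -/
lemma HasDerivWithinAt.continuousWithinAt_mul_log {s : Set ℝ} {q : ℝ → ℂ} {q' : ℂ}
    (hq : HasDerivWithinAt q q' s 0) (hq0 : q 0 = 0) :
    ContinuousWithinAt (fun x : ℝ => q x * (Real.log x : ℂ)) s 0 := by
  have hO : q =O[nhdsWithin 0 s] fun x : ℝ => x := by
    simpa [hq0] using hq.hasFDerivWithinAt.isBigO_sub
  have hO_mul : (fun x : ℝ => q x * (Real.log x : ℂ)) =O[nhdsWithin 0 s]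
      fun x : ℝ => x * Real.log x :=
    hO.mul (Asymptotics.isBigO_of_le _ fun x => by simp)
  have hlim : Filter.Tendsto (fun x : ℝ => x * Real.log x) (nhdsWithin 0 s) (nhds 0) := by
    simpa using (Real.continuous_mul_log.tendsto 0).mono_left nhdsWithin_le_nhds
  simpa [ContinuousWithinAt] using hO_mul.trans_tendsto hlim

/-- The singularity-separation identity underlying the new Levin method:
if `q' + iwg'q = f` on `[0,a]` with `q(0)=0`, and `h` is continuous on `[0,a]`,
differentiable on `(0,a]` with `h' + iwg'h = -q(x)/x`, then
`∫_0^a f log x e^{iwg} dx = (q(a)log a + h(a)) e^{iwg(a)} - h(0) e^{iwg(0)}`. -/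
theorem stmt_6 (a : ℝ) (ha : 0 < a) (w : ℝ)
    (g : ℝ → ℝ) (hg : ContDiffOn ℝ 1 g (Icc 0 a))
    (f : ℝ → ℂ) (hf : ContinuousOn f (Icc 0 a))
    (q : ℝ → ℂ) (hq : ContDiffOn ℝ 1 q (Icc 0 a)) (hq0 : q 0 = 0)
    (hqode : ∀ x ∈ Icc 0 a,
      derivWithin q (Icc 0 a) x
        + Complex.I * w * (derivWithin g (Icc 0 a) x) * q x = f x)
    (h h' : ℝ → ℂ) (hhc : ContinuousOn h (Icc 0 a))
    (hhd : ∀ x ∈ Ioc 0 a, HasDerivWithinAt h (h' x) (Icc 0 a) x)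
    (hhode : ∀ x ∈ Ioc 0 a,
      h' x + Complex.I * w * (derivWithin g (Icc 0 a) x) * h x = - q x / (x : ℂ)) :
    IntegrableOn
      (fun x : ℝ => f x * (Real.log x : ℂ) * Complex.exp (Complex.I * w * g x))
      (Ioc 0 a) volume ∧
    ∫ x in Ioc 0 a, f x * (Real.log x : ℂ) * Complex.exp (Complex.I * w * g x)
      = (q a * (Real.log a : ℂ) + h a) * Complex.exp (Complex.I * w * g a)
        - h 0 * Complex.exp (Complex.I * w * g 0) := by
  have hgc := hg.continuousOn
  have hqc := hq.continuousOn
  have hgd : ∀ x ∈ Icc 0 a, HasDerivWithinAt g (derivWithin g (Icc 0 a) x) (Icc 0 a) x :=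
    fun x hx => (hg.differentiableOn one_ne_zero x hx).hasDerivWithinAt
  have hqd : ∀ x ∈ Icc 0 a, HasDerivWithinAt q (derivWithin q (Icc 0 a) x) (Icc 0 a) x :=
    fun x hx => (hq.differentiableOn one_ne_zero x hx).hasDerivWithinAt
  have hexp : ContinuousOn (fun x : ℝ => Complex.exp (Complex.I * w * g x)) (Icc 0 a) :=
    Complex.continuous_exp.comp_continuousOn
      (continuousOn_const.mul (Complex.continuous_ofReal.comp_continuousOn hgc))
  have h_integrable : IntervalIntegrable
      (fun x : ℝ => f x * (Real.log x : ℂ) * Complex.exp (Complex.I * w * g x)) volume 0 a := by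
    have hlog : IntervalIntegrable (fun x : ℝ => (Real.log x : ℂ)) volume 0 a :=
      ⟨intervalIntegral.intervalIntegrable_log'.1.ofReal,
        intervalIntegral.intervalIntegrable_log'.2.ofReal⟩
    rw [← uIcc_of_le ha.le] at hf hexp
    exact (hlog.continuousOn_mul hf).mul_continuousOn hexp
  refine ⟨(intervalIntegrable_iff_integrableOn_Ioc_of_le ha.le).1 h_integrable, ?_⟩
  have hqlog : ContinuousOn (fun x : ℝ => q x * (Real.log x : ℂ)) (Icc 0 a) := by
    intro x hx
    rcases hx.1.eq_or_lt with rfl | hx0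
    · exact (hqd 0 hx).continuousWithinAt_mul_log hq0
    · exact (hqc x hx).mul (Complex.continuous_ofReal.continuousAt.comp
        (Real.continuousAt_log hx0.ne')).continuousWithinAt
  have hderiv : ∀ x ∈ Ioo 0 a, HasDerivAt
      (fun x : ℝ => (q x * (Real.log x : ℂ) + h x) * Complex.exp (Complex.I * w * g x))
      (f x * (Real.log x : ℂ) * Complex.exp (Complex.I * w * g x)) x := by
    intro x hx
    have hmem : Icc 0 a ∈ nhds x := Icc_mem_nhds hx.1 hx.2
    have hx0 : (x : ℂ) ≠ 0 := Complex.ofReal_ne_zero.2 hx.1.ne'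
    have hxI := Ioo_subset_Icc_self hx
    have hg1 := ((hgd x hxI).hasDerivAt hmem).ofReal_comp
    have hq1 := (hqd x hxI).hasDerivAt hmem
    have hh1 := (hhd x (Ioo_subset_Ioc_self hx)).hasDerivAt hmem
    have hl1 := (Real.hasDerivAt_log hx.1.ne').ofReal_comp
    refine (((hq1.mul hl1).add hh1).mul (hg1.const_mul (Complex.I * w)).cexp).congr_deriv ?_
    have hode := hhode x (Ioo_subset_Ioc_self hx)
    rw [← hqode x hxI]
    simp only [Pi.add_apply, Pi.mul_apply, Complex.ofReal_inv]
    rw [neg_div, div_eq_mul_inv] at hode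
    linear_combination Complex.exp (Complex.I * w * g x) * hode
  rw [← intervalIntegral.integral_of_le ha.le,
    intervalIntegral.integral_eq_sub_of_hasDerivAt_of_le ha.le ((hqlog.add hhc).mul hexp)
      hderiv h_integrable]
  simp
end

section
/- Let a > 0. There exists a constant C > 0, depending only on a, such that for every real w > 0 and every f ∈ C^1([0,a], ℂ): |∫_0^a log(x) · f(x) · e^{iwx} dx| ≤ C · (1 + |log w|) · w^{-1} · ( |f(a)| + ∫_0^a |f'(x)| dx ). -/
open Set MeasureTheory

lemma norm_exp_I_mul_ofReal_mul_ofReal (w x : ℝ) : ‖Complex.exp (Complex.I * w * x)‖ = 1 := by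
  rw [show Complex.I * w * x = ((w * x : ℝ) : ℂ) * Complex.I by push_cast; ring]
  exact Complex.norm_exp_ofReal_mul_I _

lemma intervalIntegrable_log_mul_exp (w b c : ℝ) :
    IntervalIntegrable (fun x : ℝ => (Real.log x : ℂ) * Complex.exp (Complex.I * w * x))
      volume b c := by
  have h : IntervalIntegrable (fun x : ℝ => (Real.log x : ℂ)) volume b c :=
    ⟨intervalIntegral.intervalIntegrable_log'.1.ofReal,
      intervalIntegral.intervalIntegrable_log'.2.ofReal⟩
  exact h.mul_continuousOn (by fun_prop)

/-- Absolute estimate of the oscillatory integral of `log` within one wavelength of `0`. -/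
lemma norm_integral_log_mul_exp_le_of_le_inv {w x : ℝ} (hx : 0 ≤ x)
    (hxw : x ≤ w⁻¹) :
    ‖∫ t in (0 : ℝ)..x, (Real.log t : ℂ) * Complex.exp (Complex.I * w * t)‖
      ≤ (1 + |Real.log w|) * w⁻¹ := by
  have hlogInt : ∀ b c : ℝ, IntervalIntegrable
      (fun t : ℝ => |Real.log w| - Real.log w - Real.log t) volume b c := fun b c =>
    intervalIntegrable_const.sub intervalIntegral.intervalIntegrable_log'
  have hpt : ∀ t ∈ Ioc 0 w⁻¹, |Real.log t| ≤ |Real.log w| - Real.log w - Real.log t := by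
    intro t ht
    have h1 : Real.log t ≤ -Real.log w := by
      rw [← Real.log_inv]
      exact Real.log_le_log ht.1 ht.2
    have h2 := le_abs_self (Real.log w)
    have h3 := neg_abs_le (Real.log w)
    exact abs_le.2 ⟨by linarith, by linarith⟩
  calc _ ≤ ∫ t in (0 : ℝ)..x, (|Real.log w| - Real.log w - Real.log t) := by
        refine intervalIntegral.norm_integral_le_of_norm_le hx ?_ (hlogInt _ _)
        filter_upwards with t ht
        rw [norm_mul, norm_exp_I_mul_ofReal_mul_ofReal, mul_one, Complex.norm_real]
        exact hpt t ⟨ht.1, ht.2.trans hxw⟩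
    _ ≤ ∫ t in (0 : ℝ)..w⁻¹, (|Real.log w| - Real.log w - Real.log t) := by
        refine intervalIntegral.integral_mono_interval le_rfl hx hxw ?_ (hlogInt _ _)
        filter_upwards [ae_restrict_mem measurableSet_Ioc] with t ht
        exact (abs_nonneg _).trans (hpt t ht)
    _ = (1 + |Real.log w|) * w⁻¹ := by
        rw [intervalIntegral.integral_sub intervalIntegrable_const
          intervalIntegral.intervalIntegrable_log', integral_log,
          intervalIntegral.integral_const, Real.log_inv, smul_eq_mul]
        ring

/-- Estimate of the oscillatory integral of `log` away from `0`, by one integration by parts. -/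
lemma norm_integral_log_mul_exp_le_of_pos {w b c : ℝ} (hw : 0 < w) (hb : 0 < b) (hbc : b ≤ c) :
    ‖∫ t in b..c, (Real.log t : ℂ) * Complex.exp (Complex.I * w * t)‖
      ≤ 2 * (|Real.log b| + |Real.log c|) * w⁻¹ := by
  have hw' : Complex.I * (w : ℂ) ≠ 0 := by simp [hw.ne']
  have hpos : ∀ t ∈ uIcc b c, 0 < t := by
    intro t ht
    rw [uIcc_of_le hbc] at ht
    exact hb.trans_le ht.1
  have hE : ∀ t : ℝ, ‖Complex.exp (Complex.I * w * t) / (Complex.I * w)‖ = w⁻¹ := by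
    intro t
    rw [norm_div, norm_exp_I_mul_ofReal_mul_ofReal, norm_mul, Complex.norm_I, Complex.norm_real,
      Real.norm_of_nonneg hw.le, one_mul, one_div]
  have hu : ∀ t ∈ uIcc b c, HasDerivAt (fun t : ℝ => (Real.log t : ℂ)) ((t⁻¹ : ℝ) : ℂ) t :=
    fun t ht => (Real.hasDerivAt_log (hpos t ht).ne').ofReal_comp
  have hv : ∀ t ∈ uIcc b c, HasDerivAt
      (fun t : ℝ => Complex.exp (Complex.I * w * t) / (Complex.I * w))
      (Complex.exp (Complex.I * w * t)) t := by
    intro t _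
    have h1 : HasDerivAt (fun t : ℝ => Complex.I * w * (t : ℂ)) (Complex.I * w) t := by
      simpa using (Complex.ofRealCLM.hasDerivAt (x := t)).const_mul (Complex.I * (w : ℂ))
    have h2 := h1.cexp.div_const (Complex.I * (w : ℂ))
    rwa [mul_div_cancel_right₀ _ hw'] at h2
  have hinv : IntervalIntegrable (fun t : ℝ => t⁻¹) volume b c :=
    (continuousOn_id.inv₀ fun t ht => (hpos t ht).ne').intervalIntegrable
  rw [intervalIntegral.integral_mul_deriv_eq_deriv_mul hu hv
    ⟨hinv.1.ofReal, hinv.2.ofReal⟩ (Continuous.intervalIntegrable (by fun_prop) _ _)]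
  have hI : ‖∫ t in b..c, ((t⁻¹ : ℝ) : ℂ) * (Complex.exp (Complex.I * w * t) / (Complex.I * w))‖
      ≤ (Real.log c - Real.log b) * w⁻¹ := by
    calc _ ≤ ∫ t in b..c, t⁻¹ * w⁻¹ := by
          refine intervalIntegral.norm_integral_le_of_norm_le hbc ?_ (hinv.mul_const _)
          filter_upwards with t ht
          rw [norm_mul, hE, Complex.norm_real, Real.norm_of_nonneg]
          exact inv_nonneg.2 (hb.trans ht.1).le
      _ = _ := by
          rw [intervalIntegral.integral_mul_const, integral_inv_of_pos hb (hb.trans_le hbc),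
            Real.log_div (hb.trans_le hbc).ne' hb.ne']
  refine (norm_sub_le _ _).trans ?_
  refine (add_le_add (norm_sub_le _ _) hI).trans ?_
  rw [norm_mul, norm_mul, hE, hE, Complex.norm_real, Complex.norm_real, Real.norm_eq_abs,
    Real.norm_eq_abs, ← add_mul, ← add_mul]
  refine mul_le_mul_of_nonneg_right ?_ (inv_nonneg.2 hw.le)
  linarith [le_abs_self (Real.log c), neg_abs_le (Real.log b)]

lemma norm_integral_log_mul_exp_le {a w x : ℝ} (hw : 0 < w) (hx : 0 ≤ x) (hxa : x ≤ a) :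
    ‖∫ t in (0 : ℝ)..x, (Real.log t : ℂ) * Complex.exp (Complex.I * w * t)‖
      ≤ 5 * (1 + |Real.log a|) * (1 + |Real.log w|) * w⁻¹ := by
  have hw' : 0 < w⁻¹ := inv_pos.2 hw
  have hA := abs_nonneg (Real.log a)
  have hW := abs_nonneg (Real.log w)
  have hAW := mul_nonneg hA hW
  rcases le_total x w⁻¹ with h | h
  · refine (norm_integral_log_mul_exp_le_of_le_inv hx h).trans ?_
    exact mul_le_mul_of_nonneg_right (by nlinarith) hw'.le
  · rw [← intervalIntegral.integral_add_adjacent_intervals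
      (intervalIntegrable_log_mul_exp w 0 w⁻¹) (intervalIntegrable_log_mul_exp w w⁻¹ x)]
    refine (norm_add_le _ _).trans ((add_le_add
      (norm_integral_log_mul_exp_le_of_le_inv hw'.le le_rfl)
      (norm_integral_log_mul_exp_le_of_pos hw hw' h)).trans ?_)
    have h1 : -Real.log w ≤ Real.log x := by
      rw [← Real.log_inv]
      exact Real.log_le_log hw' h
    have h2 : Real.log x ≤ Real.log a := Real.log_le_log (hw'.trans_le h) hxa
    have h3 : |Real.log x| ≤ |Real.log w| + |Real.log a| := abs_le.2
      ⟨by linarith [le_abs_self (Real.log w)], by linarith [le_abs_self (Real.log a)]⟩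
    rw [Real.log_inv, abs_neg, ← add_mul]
    exact mul_le_mul_of_nonneg_right (by nlinarith) hw'.le

/-- If all primitives `∫ t in 0..x, g t` are bounded by `K`, then integrating `g` against a `C¹`
function `f` costs at most `K` times `‖f a‖` plus the variation of `f`. -/
lemma norm_integral_mul_le_of_primitive_bound {a K : ℝ} (ha : 0 < a) {f g : ℝ → ℂ}
    (hf : ContDiffOn ℝ 1 f (Icc 0 a)) (hg : ∀ b c, IntervalIntegrable g volume b c)
    (hgc : ∀ x ∈ Ioo 0 a, ContinuousAt g x) (hgm : StronglyMeasurable g)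
    (hK : ∀ x ∈ Icc 0 a, ‖∫ t in (0 : ℝ)..x, g t‖ ≤ K) :
    ‖∫ x in (0 : ℝ)..a, f x * g x‖
      ≤ K * (‖f a‖ + ∫ x in (0 : ℝ)..a, ‖derivWithin f (Icc 0 a) x‖) := by
  have hf' : ContinuousOn (derivWithin f (Icc 0 a)) (Icc 0 a) :=
    hf.continuousOn_derivWithin (uniqueDiffOn_Icc ha) le_rfl
  have hf'i : IntervalIntegrable (derivWithin f (Icc 0 a)) volume 0 a :=
    ContinuousOn.intervalIntegrable (by rwa [uIcc_of_le ha.le])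
  have hder : ∀ x ∈ Ioo (min 0 a) (max 0 a), HasDerivAt f (derivWithin f (Icc 0 a) x) x := by
    intro x hx
    rw [min_eq_left ha.le, max_eq_right ha.le] at hx
    exact ((hf.differentiableOn one_ne_zero x (Ioo_subset_Icc_self hx)).hasDerivWithinAt).hasDerivAt
      (Icc_mem_nhds hx.1 hx.2)
  have hprim : ∀ x ∈ Ioo (min 0 a) (max 0 a),
      HasDerivAt (fun x => ∫ t in (0 : ℝ)..x, g t) (g x) x := by
    intro x hx
    rw [min_eq_left ha.le, max_eq_right ha.le] at hx
    exact intervalIntegral.integral_hasDerivAt_right (hg _ _)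
      hgm.stronglyMeasurableAtFilter (hgc x hx)
  rw [intervalIntegral.integral_mul_deriv_eq_deriv_mul_of_hasDerivAt
    (by rw [uIcc_of_le ha.le]; exact hf.continuousOn)
    (intervalIntegral.continuous_primitive hg 0).continuousOn hder hprim hf'i (hg _ _),
    intervalIntegral.integral_same, mul_zero, sub_zero, mul_add,
    ← intervalIntegral.integral_const_mul K]
  refine (norm_sub_le _ _).trans (add_le_add ?_ ?_)
  · rw [norm_mul, mul_comm]
    exact mul_le_mul_of_nonneg_right (hK a ⟨ha.le, le_rfl⟩) (norm_nonneg _)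
  · refine intervalIntegral.norm_integral_le_of_norm_le ha.le ?_ (hf'i.norm.const_mul _)
    filter_upwards with x hx
    rw [norm_mul, mul_comm]
    exact mul_le_mul_of_nonneg_right (hK x (Ioc_subset_Icc_self hx)) (norm_nonneg _)

/-- Van der Corput-type estimate (Lemma 3): there is `C = C(a) > 0` such that for every
`w > 0` and `f ∈ C¹([0,a],ℂ)`,
`|∫_0^a log x · f(x) e^{iwx} dx| ≤ C (1+|log w|) w⁻¹ (|f(a)| + ∫_0^a |f'|)`. -/
theorem stmt_9 (a : ℝ) (ha : 0 < a) :
    ∃ C > 0, ∀ w : ℝ, 0 < w → ∀ f : ℝ → ℂ, ContDiffOn ℝ 1 f (Icc 0 a) →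
      ‖∫ x in Ioc 0 a, (Real.log x : ℂ) * f x * Complex.exp (Complex.I * w * x)‖
        ≤ C * (1 + |Real.log w|) * w⁻¹ *
          (‖f a‖ + ∫ x in Ioc 0 a, ‖derivWithin f (Icc 0 a) x‖) := by
  refine ⟨5 * (1 + |Real.log a|), by positivity, fun w hw f hf => ?_⟩
  rw [← intervalIntegral.integral_of_le ha.le, ← intervalIntegral.integral_of_le ha.le]
  have hgm : StronglyMeasurable
      (fun x : ℝ => (Real.log x : ℂ) * Complex.exp (Complex.I * w * x)) :=
    Measurable.stronglyMeasurable (by fun_prop)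
  have hgc : ∀ x ∈ Ioo 0 a,
      ContinuousAt (fun x : ℝ => (Real.log x : ℂ) * Complex.exp (Complex.I * w * x)) x := by
    intro x hx
    have hlog : ContinuousAt (fun x : ℝ => (Real.log x : ℂ)) x :=
      Complex.continuous_ofReal.continuousAt.comp (Real.continuousAt_log hx.1.ne')
    exact hlog.mul (by fun_prop)
  have h := norm_integral_mul_le_of_primitive_bound ha hf (intervalIntegrable_log_mul_exp w)
    hgc hgm fun x hx => norm_integral_log_mul_exp_le hw hx.1 hx.2
  convert h using 4
  ring
end

section
/- Let a > 0, let w ∈ ℝ with w ≠ 0, let n ≥ 1 be an integer, let 0 ≤ x̂_0 < x̂_1 < … < x̂_{n-1} ≤ a be distinct nodes, and let f : [0,a] → ℂ. Suppose q̂₁ is a complex polynomial of degree ≤ n-1 satisfying the collocation equations q̂₁'(x̂_j) + i·w·q̂₁(x̂_j) = f(x̂_j) for j = 0, …, n-1. Let q̂₂ be the polynomial with q̂₂(x)·x = q̂₁(x) − q̂₁(0) (which exists since q̂₁ − q̂₁(0) vanishes at 0), let ĥ₁ be the (unique) polynomial of degree ≤ n-1 satisfying ĥ₁' + i·w·ĥ₁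 = −q̂₂ identically, and set ĥ₂(a) = q̂₁(0)·e^{-iwa}·∫_0^a (1 − e^{iwt})/t dt. Let f̂ be the unique polynomial of degree ≤ n-1 interpolating f at the nodes x̂_0, …, x̂_{n-1}. Then the new Levin quadrature equals the Filon quadrature: (q̂₁(a) − q̂₁(0)·e^{-iwa})·e^{iwa}·log(a) + (ĥ₁(a) + ĥ₂(a))·e^{iwa} − ĥ₁(0) = ∫_0^a f̂(x) · log(x) · e^{iwx} dx. -/
open Set MeasureTheory Polynomial

/-- If `p' + c p` and `r` have degree `< n` and agree at `n` distinct nodes, they are equal. -/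
theorem derivative_add_C_mul_eq_of_eval_eq {n : ℕ} {x : Fin n → ℂ} (hx : Function.Injective x)
    {p r : ℂ[X]} (c : ℂ) (hp : p.degree < n) (hr : r.degree < n)
    (h : ∀ j, (derivative p).eval (x j) + c * p.eval (x j) = r.eval (x j)) :
    derivative p + C c * p = r := by
  refine Polynomial.eq_of_degrees_lt_of_eval_index_eq (s := Finset.univ) (v := x)
    hx.injOn ?_ ?_ fun j _ => ?_
  · rw [Finset.card_univ, Fintype.card_fin]
    refine (degree_add_le _ _).trans_lt (max_lt ?_ ?_)
    · exact degree_derivative_le.trans_lt hp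
    · rw [← smul_eq_C_mul]
      exact (degree_smul_le _ _).trans_lt hp
  · simpa using hr
  · simpa using h j

theorem hasDerivAt_cexp_const_mul_ofReal (c : ℂ) (x : ℝ) :
    HasDerivAt (fun t : ℝ => Complex.exp (c * t)) (Complex.exp (c * x) * c) x := by
  have h := (((hasDerivAt_id (x : ℂ)).const_mul c).cexp).comp_ofReal
  simpa using h

theorem hasDerivAt_eval_mul_cexp (p : ℂ[X]) (c : ℂ) (x : ℝ) :
    HasDerivAt (fun t : ℝ => p.eval (t : ℂ) * Complex.exp (c * t))
      ((derivative p + C c * p).eval (x : ℂ) * Complex.exp (c * x)) x := by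
  refine ((p.hasDerivAt (x : ℂ)).comp_ofReal.mul
    (hasDerivAt_cexp_const_mul_ofReal c x)).congr_deriv ?_
  simp only [eval_add, eval_mul, eval_C]
  ring

theorem continuous_dslope_of_differentiable {F : ℝ → ℂ} (hF : Differentiable ℝ F) (b : ℝ) :
    Continuous (dslope F b) := by
  rw [← continuousOn_univ]
  exact (continuousOn_dslope Filter.univ_mem).2 ⟨hF.continuous.continuousOn, hF b⟩

/-- A differentiable function vanishing at `0` stays continuous when multiplied by `log`. -/
theorem continuous_mul_log_of_differentiable {F : ℝ → ℂ} (hF : Differentiable ℝ F)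
    (h0 : F 0 = 0) : Continuous fun x : ℝ => F x * (Real.log x : ℂ) := by
  have h : (fun x : ℝ => F x * (Real.log x : ℂ))
      = fun x : ℝ => dslope F 0 x * ((x * Real.log x : ℝ) : ℂ) := by
    ext x
    have := sub_smul_dslope F 0 x
    simp only [sub_zero, h0, Complex.real_smul] at this
    rw [← this]
    push_cast
    ring
  rw [h]
  exact (continuous_dslope_of_differentiable hF 0).mul
    (Complex.continuous_ofReal.comp Real.continuous_mul_log)

theorem intervalIntegrable_one_sub_cexp_div (c : ℂ) (a b : ℝ) :
    IntervalIntegrable (fun t : ℝ => (1 - Complex.exp (c * t)) / (t : ℂ)) volume a b := by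
  have hd : Differentiable ℝ fun t : ℝ => 1 - Complex.exp (c * t) := fun x =>
    ((hasDerivAt_cexp_const_mul_ofReal c x).const_sub 1).differentiableAt
  refine ((continuous_dslope_of_differentiable hd 0).intervalIntegrable a b).congr_ae ?_
  refine ae_restrict_of_ae ?_
  filter_upwards [Measure.ae_ne volume (0 : ℝ)] with x hx
  rw [dslope_of_ne _ hx, slope_def_module]
  simp [div_eq_inv_mul]

/-- Theorem 1 (equivalence of the new Levin method and the Filon method for the linear
oscillator `g(x) = x`): with collocation polynomials `q̂₁, q̂₂, ĥ₁`, the value `ĥ₂(a)` given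
in closed form, and the Lagrange interpolant `f̂` of `f` at the same nodes, the Levin
quadrature equals the Filon quadrature `∫_0^a f̂(x) log x e^{iwx} dx`. -/
theorem stmt_10 (a : ℝ) (ha : 0 < a) (w : ℝ) (hw : w ≠ 0)
    (n : ℕ) (hn : 1 ≤ n)
    (xh : Fin n → ℝ) (hmono : StrictMono xh)
    (hfirst : 0 ≤ xh ⟨0, by omega⟩) (hlast : xh ⟨n - 1, by omega⟩ ≤ a)
    (f : ℝ → ℂ)
    (q1 : Polynomial ℂ) (hq1deg : q1.degree < (n : ℕ))
    (hq1 : ∀ j : Fin n,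
      (derivative q1).eval ((xh j : ℝ) : ℂ) + Complex.I * w * q1.eval ((xh j : ℝ) : ℂ)
        = f (xh j))
    (q2 : Polynomial ℂ) (hq2 : q2 * X = q1 - C (q1.eval 0))
    (h1 : Polynomial ℂ) (hh1deg : h1.degree < (n : ℕ))
    (hh1 : derivative h1 + C (Complex.I * w) * h1 = - q2)
    (fhat : Polynomial ℂ) (hfhatdeg : fhat.degree < (n : ℕ))
    (hfhat : ∀ j : Fin n, fhat.eval ((xh j : ℝ) : ℂ) = f (xh j)) :
    (q1.eval (a : ℂ) - q1.eval 0 * Complex.exp (-(Complex.I * w * a)))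
        * Complex.exp (Complex.I * w * a) * (Real.log a : ℂ)
      + (h1.eval (a : ℂ)
          + q1.eval 0 * Complex.exp (-(Complex.I * w * a))
              * ∫ t in Ioc 0 a, (1 - Complex.exp (Complex.I * w * t)) / (t : ℂ))
          * Complex.exp (Complex.I * w * a)
      - h1.eval 0
    = ∫ x in Ioc 0 a, fhat.eval ((x : ℝ) : ℂ) * (Real.log x : ℂ)
        * Complex.exp (Complex.I * w * x) := by
  have key : derivative q1 + C (Complex.I * w) * q1 = fhat :=
    derivative_add_C_mul_eq_of_eval_eq (x := fun j => ((xh j : ℝ) : ℂ))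
      (Complex.ofReal_injective.comp hmono.injective) _ hq1deg hfhatdeg
      fun j => (hq1 j).trans (hfhat j).symm
  set c : ℂ := Complex.I * w
  have hF (x : ℝ) : HasDerivAt (fun t : ℝ => q1.eval (t : ℂ) * Complex.exp (c * t) - q1.eval 0)
      (fhat.eval (x : ℂ) * Complex.exp (c * x)) x := by
    simpa only [key] using (hasDerivAt_eval_mul_cexp q1 c x).sub_const (q1.eval 0)
  have hH (x : ℝ) : HasDerivAt (fun t : ℝ => h1.eval (t : ℂ) * Complex.exp (c * t))
      ((-q2).eval (x : ℂ) * Complex.exp (c * x)) x := by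
    simpa only [hh1] using hasDerivAt_eval_mul_cexp h1 c x
  have hlogint : IntervalIntegrable (fun x : ℝ => fhat.eval (x : ℂ) * (Real.log x : ℂ)
      * Complex.exp (c * x)) volume 0 a := by
    have hlog : IntervalIntegrable (fun x : ℝ => (Real.log x : ℂ)) volume 0 a :=
      have h := intervalIntegral.intervalIntegrable_log' (a := 0) (b := a)
      ⟨h.1.ofReal, h.2.ofReal⟩
    exact (hlog.continuousOn_mul (by fun_prop)).mul_continuousOn (by fun_prop)
  have hexpint := intervalIntegrable_one_sub_cexp_div c 0 a
  have hftc := intervalIntegral.integral_eq_sub_of_hasDerivAt_of_le ha.le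
    (f := fun x : ℝ => (q1.eval (x : ℂ) * Complex.exp (c * x) - q1.eval 0) * (Real.log x : ℂ)
      + h1.eval (x : ℂ) * Complex.exp (c * x))
    (f' := fun x : ℝ => fhat.eval (x : ℂ) * (Real.log x : ℂ) * Complex.exp (c * x)
      - q1.eval 0 * ((1 - Complex.exp (c * x)) / (x : ℂ)))
    ((continuous_mul_log_of_differentiable (fun x => (hF x).differentiableAt) (by simp)).add
      (by fun_prop)).continuousOn
    (fun x hx => by
      have hx0 : (x : ℂ) ≠ 0 := by exact_mod_cast hx.1.ne'
      refine (((hF x).mul (Real.hasDerivAt_log hx.1.ne').ofReal_comp).add (hH x)).congr_deriv ?_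
      have hq : q2.eval (x : ℂ) * x = q1.eval (x : ℂ) - q1.eval 0 := by
        simpa using congrArg (eval (x : ℂ)) hq2
      rw [eval_neg, Complex.ofReal_inv]
      field_simp
      linear_combination -Complex.exp (c * x) * hq)
    (hlogint.sub (hexpint.const_mul _))
  rw [intervalIntegral.integral_sub hlogint (hexpint.const_mul _),
    intervalIntegral.integral_const_mul, intervalIntegral.integral_of_le ha.le,
    intervalIntegral.integral_of_le ha.le] at hftc
  simp only [Complex.ofReal_zero, Real.log_zero, mul_zero, Complex.exp_zero, mul_one,
    zero_add] at hftc
  have hexp : Complex.exp (-(c * a)) * Complex.exp (c * a) = 1 := by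
    rw [← Complex.exp_add, neg_add_cancel, Complex.exp_zero]
  linear_combination -hftc + (q1.eval 0 *
    (∫ t in Ioc 0 a, (1 - Complex.exp (c * t)) / (t : ℂ)) - q1.eval 0 * (Real.log a : ℂ)) * hexp
end

section
/- Let a > 0. There exists a constant C > 0, depending only on a, such that for every integer n ≥ 2, every f ∈ C^n([0,a], ℂ), every choice of distinct nodes 0 ≤ x̂_0 < x̂_1 < … < x̂_{n-1} ≤ a, and every real w > 0: |∫_0^a (f(x) − f̂(x)) · log(x) · e^{iwx} dx| ≤ C · (1 + |log w|) · w^{-1} · ‖f^{(n)}‖_∞ · a^n / (n-1)!, where f̂ is the Lagrange interpolant of f of degree ≤ n-1 at the nodes. -/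
open Set MeasureTheory Polynomial

/-- **Rolle's theorem for several zeros.** -/
theorem exists_strictMono_deriv_zero {a b : ℝ} {m : ℕ} {g g' : ℝ → ℝ}
    (hg : ∀ x ∈ Icc a b, HasDerivWithinAt g (g' x) (Icc a b) x)
    {x : Fin (m + 1) → ℝ} (hx : StrictMono x) (hmem : ∀ j, x j ∈ Icc a b)
    (hzero : ∀ j, g (x j) = 0) :
    ∃ y : Fin m → ℝ, StrictMono y ∧ (∀ j, y j ∈ Icc a b) ∧ ∀ j, g' (y j) = 0 := by
  have key : ∀ j : Fin m, ∃ y ∈ Ioo (x j.castSucc) (x j.succ), g' y = 0 := fun j ↦ by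
    have hsub : Icc (x j.castSucc) (x j.succ) ⊆ Icc a b :=
      Icc_subset_Icc (hmem _).1 (hmem _).2
    refine exists_hasDerivAt_eq_zero (hx j.castSucc_lt_succ)
      (fun y hy ↦ ((hg y (hsub hy)).continuousWithinAt).mono hsub) (by rw [hzero, hzero])
      fun y hy ↦ (hg y (hsub (Ioo_subset_Icc_self hy))).hasDerivAt ?_
    exact Icc_mem_nhds ((hmem _).1.trans_lt hy.1) (hy.2.trans_le (hmem _).2)
  choose y hy hy0 using key
  refine ⟨y, fun i j hij ↦ (hy i).2.trans_le ?_ |>.trans (hy j).1,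
    fun j ↦ ⟨(hmem _).1.trans (hy j).1.le, (hy j).2.le.trans (hmem _).2⟩, hy0⟩
  exact hx.monotone (Fin.succ_le_castSucc_iff.2 hij)

/-- If `G 0` has `m + 1` zeros and `G (k + 1)` is the derivative of `G k`, then `G m` has
a zero. -/
theorem exists_zero_of_hasDerivWithinAt_chain {a b : ℝ} {m : ℕ} {G : ℕ → ℝ → ℝ}
    (hG : ∀ k < m, ∀ x ∈ Icc a b, HasDerivWithinAt (G k) (G (k + 1) x) (Icc a b) x)
    {x : Fin (m + 1) → ℝ} (hx : StrictMono x) (hmem : ∀ j, x j ∈ Icc a b)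
    (hzero : ∀ j, G 0 (x j) = 0) : ∃ ξ ∈ Icc a b, G m ξ = 0 := by
  induction m generalizing G with
  | zero => exact ⟨x 0, hmem 0, hzero 0⟩
  | succ m ih =>
    obtain ⟨y, hy, hymem, hy0⟩ :=
      exists_strictMono_deriv_zero (hG 0 (Nat.succ_pos m)) hx hmem hzero
    exact ih (G := fun k ↦ G (k + 1)) (fun k hk ↦ hG (k + 1) (by lia)) hy hymem hy0

theorem Polynomial.Monic.iterate_derivative_natDegree {R : Type*} [CommRing R] {p : R[X]}
    (hp : p.Monic) : derivative^[p.natDegree] p = C (p.natDegree.factorial : R) := by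
  have h : (derivative^[p.natDegree] p).natDegree ≤ 0 := by
    simpa using natDegree_iterate_derivative p p.natDegree
  rw [eq_C_of_natDegree_le_zero h, coeff_iterate_derivative]
  simp [hp.coeff_natDegree, Nat.descFactorial_self]

/-- The classical bound for a function vanishing at `m` distinct nodes, in terms of its
`m`-th derivative. -/
theorem abs_le_of_zeros_of_hasDerivWithinAt_chain {a M : ℝ} (hM : 0 ≤ M) {m : ℕ}
    {G : ℕ → ℝ → ℝ}
    (hG : ∀ k < m, ∀ x ∈ Icc 0 a, HasDerivWithinAt (G k) (G (k + 1) x) (Icc 0 a) x)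
    (hbound : ∀ x ∈ Icc 0 a, |G m x| ≤ M)
    {y : Fin m → ℝ} (hy : StrictMono y) (hmem : ∀ j, y j ∈ Icc 0 a)
    (hzero : ∀ j, G 0 (y j) = 0) {x : ℝ} (hx : x ∈ Icc 0 a) :
    |G 0 x| ≤ M * a ^ m / m.factorial := by
  have ha : 0 ≤ a := hx.1.trans hx.2
  by_cases hxy : x ∈ Set.range y
  · obtain ⟨j, rfl⟩ := hxy
    rw [hzero, abs_zero]
    positivity
  set p : ℝ[X] := ∏ j, (X - C (y j)) with hp
  have hdeg : p.natDegree = m := by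
    rw [hp, natDegree_prod_of_monic _ _ fun j _ ↦ monic_X_sub_C (y j)]
    simp
  have hpm : p.Monic := monic_prod_of_monic _ _ fun j _ ↦ monic_X_sub_C _
  have hpeval (z : ℝ) : p.eval z = ∏ j, (z - y j) := by simp [hp, eval_prod]
  have hpx : p.eval x ≠ 0 := by
    rw [hpeval, Finset.prod_ne_zero_iff]
    exact fun j _ h ↦ hxy ⟨j, by linarith⟩
  set K := G 0 x / p.eval x with hK
  let H : ℕ → ℝ → ℝ := fun k z ↦ G k z - K * (derivative^[k] p).eval z
  have hH : ∀ k < m, ∀ x ∈ Icc 0 a, HasDerivWithinAt (H k) (H (k + 1) x) (Icc 0 a) x := by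
    intro k hk z hz
    have h := ((derivative^[k] p).hasDerivAt z).hasDerivWithinAt (s := Icc 0 a)
    rw [← Function.iterate_succ_apply' derivative] at h
    exact (hG k hk z hz).sub (h.const_mul K)
  have hcard : (insert x (Finset.univ.map ⟨y, hy.injective⟩)).card = m + 1 := by
    rw [Finset.card_insert_of_notMem (by simpa using hxy)]
    simp
  set s := insert x (Finset.univ.map ⟨y, hy.injective⟩) with hs
  have hsx : ∀ z ∈ s, z ∈ Icc 0 a ∧ H 0 z = 0 := by
    intro z hz
    simp only [hs, Finset.mem_insert, Finset.mem_map, Finset.mem_univ, true_and,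
      Function.Embedding.coeFn_mk] at hz
    rcases hz with rfl | ⟨j, rfl⟩
    · exact ⟨hx, by simp [H, hK, div_mul_cancel₀ _ hpx]⟩
    · refine ⟨hmem j, ?_⟩
      simp only [H, hzero, Function.iterate_zero, id, hpeval]
      rw [Finset.prod_eq_zero (Finset.mem_univ j) (sub_self _)]
      simp
  obtain ⟨ξ, hξ, h0⟩ := exists_zero_of_hasDerivWithinAt_chain hH
    (s.orderEmbOfFin hcard).strictMono (fun j ↦ (hsx _ (s.orderEmbOfFin_mem hcard j)).1)
    fun j ↦ (hsx _ (s.orderEmbOfFin_mem hcard j)).2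
  have hder : derivative^[m] p = C (m.factorial : ℝ) := by
    simpa [hdeg] using hpm.iterate_derivative_natDegree
  simp only [H, hder, eval_C, sub_eq_zero] at h0
  have hprod : |p.eval x| ≤ a ^ m := by
    rw [hpeval, Finset.abs_prod]
    refine (Finset.prod_le_prod (g := fun _ ↦ a) (fun j _ ↦ abs_nonneg _) fun j _ ↦ ?_).trans
      (by simp)
    have := hmem j
    rw [abs_le]
    constructor <;> linarith [this.1, this.2, hx.1, hx.2]
  have hGx : G 0 x = G m ξ * p.eval x / m.factorial := by
    rw [h0, hK]
    field_simp
  rw [hGx, abs_div, abs_mul, Nat.abs_cast]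
  gcongr
  exact hbound ξ hξ

/-- A complex-valued function with `m + 1` zeros has derivative controlled by its derivative of
order `m + 1`. -/
theorem norm_deriv_le_of_zeros_of_hasDerivWithinAt_chain {a M : ℝ} (hM : 0 ≤ M) {m : ℕ}
    {G : ℕ → ℝ → ℂ}
    (hG : ∀ k < m + 1, ∀ x ∈ Icc 0 a, HasDerivWithinAt (G k) (G (k + 1) x) (Icc 0 a) x)
    (hbound : ∀ x ∈ Icc 0 a, ‖G (m + 1) x‖ ≤ M)
    {y : Fin (m + 1) → ℝ} (hy : StrictMono y) (hmem : ∀ j, y j ∈ Icc 0 a)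
    (hzero : ∀ j, G 0 (y j) = 0) {x : ℝ} (hx : x ∈ Icc 0 a) :
    ‖G 1 x‖ ≤ M * a ^ m / m.factorial := by
  obtain ⟨c, hc, hcx⟩ := Complex.exists_norm_eq_mul_self (G 1 x)
  let H : ℕ → ℝ → ℝ := fun k z ↦ (c * G k z).re
  have hH : ∀ k < m + 1, ∀ x ∈ Icc 0 a,
      HasDerivWithinAt (H k) (H (k + 1) x) (Icc 0 a) x := fun k hk z hz ↦
    (Complex.reCLM.hasFDerivAt.comp_hasDerivWithinAt z ((hG k hk z hz).const_mul c) :)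
  obtain ⟨t, ht, htmem, ht0⟩ := exists_strictMono_deriv_zero (hH 0 (Nat.succ_pos m)) hy hmem
    fun j ↦ by simp [H, hzero]
  have key := abs_le_of_zeros_of_hasDerivWithinAt_chain (G := fun k ↦ H (k + 1)) hM
    (fun k hk ↦ hH (k + 1) (by lia))
    (fun z hz ↦ (Complex.abs_re_le_norm _).trans
      (by rw [norm_mul, hc, one_mul]; exact hbound z hz)) ht htmem ht0 hx
  simp only [H, zero_add, ← hcx] at key
  rwa [Complex.ofReal_re, abs_norm] at key

theorem norm_cexp_I_mul_ofReal_mul_ofReal (w t : ℝ) :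
    ‖Complex.exp (Complex.I * w * t)‖ = 1 := by
  rw [show Complex.I * w * t = ((w * t : ℝ) : ℂ) * Complex.I by push_cast; ring]
  exact Complex.norm_exp_ofReal_mul_I _

theorem intervalIntegrable_ofReal {f : ℝ → ℝ} {μ : Measure ℝ} {b c : ℝ}
    (hf : IntervalIntegrable f μ b c) : IntervalIntegrable (fun t ↦ (f t : ℂ)) μ b c :=
  ⟨hf.1.ofReal, hf.2.ofReal⟩

theorem intervalIntegrable_log_mul_cexp (w b c : ℝ) :
    IntervalIntegrable (fun t : ℝ ↦ (Real.log t : ℂ) * Complex.exp (Complex.I * w * t))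
      volume b c :=
  (intervalIntegrable_ofReal intervalIntegral.intervalIntegrable_log').mul_continuousOn (by fun_prop)

/-- Near the singularity, where the kernel does not oscillate. -/
theorem norm_integral_log_mul_cexp_le_of_le {w x : ℝ} (hw : 0 < w) (hx : 0 < x)
    (hxw : x ≤ w⁻¹) :
    ‖∫ t in (0 : ℝ)..x, (Real.log t : ℂ) * Complex.exp (Complex.I * w * t)‖
      ≤ (1 + |Real.log w|) * w⁻¹ := by
  have hpt : ∀ t ∈ Ioc 0 x, ‖(Real.log t : ℂ) * Complex.exp (Complex.I * w * t)‖
      ≤ (-Real.log w - Real.log t) + |Real.log w| := by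
    intro t ht
    have hlog : Real.log t ≤ -Real.log w := by
      rw [← Real.log_inv]
      exact Real.log_le_log ht.1 (ht.2.trans hxw)
    rw [norm_mul, norm_cexp_I_mul_ofReal_mul_ofReal, mul_one, Complex.norm_real, Real.norm_eq_abs,
      abs_le]
    constructor <;> cases abs_cases (Real.log w) <;> linarith
  have hint : IntervalIntegrable (fun t ↦ (-Real.log w - Real.log t) + |Real.log w|) volume 0 x :=
    (intervalIntegrable_const.sub intervalIntegral.intervalIntegrable_log').add
      intervalIntegrable_const
  refine (intervalIntegral.norm_integral_le_of_norm_le hx.le (.of_forall hpt) hint).trans ?_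
  rw [intervalIntegral.integral_add
    (intervalIntegrable_const.sub intervalIntegral.intervalIntegrable_log')
    intervalIntegrable_const, intervalIntegral.integral_sub intervalIntegrable_const
    intervalIntegral.intervalIntegrable_log', integral_log]
  simp only [intervalIntegral.integral_const, smul_eq_mul, sub_zero, zero_mul]
  have hwx : 0 < w * x := by positivity
  have hle : -Real.log (w * x) ≤ (w * x)⁻¹ - 1 := by
    rw [← Real.log_inv]
    exact Real.log_le_sub_one_of_pos (inv_pos.2 hwx)
  rw [Real.log_mul hw.ne' hx.ne'] at hle
  have h1 := mul_le_mul_of_nonneg_left hle hx.le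
  have h2 : x * ((w * x)⁻¹ - 1) = w⁻¹ - x := by field_simp
  have h3 := mul_le_mul_of_nonneg_right hxw (abs_nonneg (Real.log w))
  nlinarith

/-- Away from the singularity, by one integration by parts. -/
theorem norm_integral_log_mul_cexp_le_of_inv_le {w x : ℝ} (hw : 0 < w) (hxw : w⁻¹ ≤ x) :
    ‖∫ t in w⁻¹..x, (Real.log t : ℂ) * Complex.exp (Complex.I * w * t)‖
      ≤ 2 * (|Real.log x| + |Real.log w|) * w⁻¹ := by
  have hw' : 0 < w⁻¹ := inv_pos.2 hw
  have hpos : ∀ t ∈ uIcc w⁻¹ x, t ≠ 0 := fun t ht ↦ by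
    rw [uIcc_of_le hxw] at ht
    exact (hw'.trans_le ht.1).ne'
  have hIw : Complex.I * w ≠ 0 := mul_ne_zero Complex.I_ne_zero (by exact_mod_cast hw.ne')
  let v : ℝ → ℂ := fun t ↦ Complex.exp (Complex.I * w * t) / (Complex.I * w)
  have hv : ∀ t : ℝ, HasDerivAt v (Complex.exp (Complex.I * w * t)) t := fun t ↦ by
    have h := (((hasDerivAt_id (t : ℂ)).const_mul (Complex.I * w)).cexp.div_const
      (Complex.I * w)).comp_ofReal
    simpa [hIw] using h
  have hvnorm : ∀ t, ‖v t‖ = w⁻¹ := fun t ↦ by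
    simp [v, norm_cexp_I_mul_ofReal_mul_ofReal, abs_of_pos hw]
  have hu : ∀ t ∈ uIcc w⁻¹ x, HasDerivAt (fun t : ℝ ↦ (Real.log t : ℂ)) ((t⁻¹ : ℝ) : ℂ) t :=
    fun t ht ↦ (Real.hasDerivAt_log (hpos t ht)).ofReal_comp
  have hinv : IntervalIntegrable (fun t : ℝ ↦ t⁻¹) volume w⁻¹ x :=
    intervalIntegral.intervalIntegrable_inv hpos continuousOn_id
  rw [intervalIntegral.integral_mul_deriv_eq_deriv_mul hu (fun t _ ↦ hv t) (intervalIntegrable_ofReal hinv)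
    (by apply Continuous.intervalIntegrable; fun_prop)]
  have hrest : ‖∫ t in w⁻¹..x, ((t⁻¹ : ℝ) : ℂ) * v t‖ ≤ (Real.log x + Real.log w) * w⁻¹ := by
    refine (intervalIntegral.norm_integral_le_of_norm_le hxw (g := fun t ↦ t⁻¹ * w⁻¹)
      (.of_forall fun t ht ↦ ?_) (hinv.mul_const _)).trans ?_
    · rw [norm_mul, hvnorm, Complex.norm_real, Real.norm_of_nonneg (inv_pos.2 (hw'.trans ht.1)).le]
    · rw [intervalIntegral.integral_mul_const,
        integral_inv_of_pos hw' (hw'.trans_le hxw), div_inv_eq_mul,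
        Real.log_mul (hw'.trans_le hxw).ne' hw.ne']
  refine (norm_sub_le _ _).trans ((add_le_add (norm_sub_le _ _) hrest).trans ?_)
  simp only [norm_mul, hvnorm, Complex.norm_real, Real.norm_eq_abs, Real.log_inv, abs_neg]
  nlinarith [le_abs_self (Real.log x), le_abs_self (Real.log w)]

theorem norm_integral_log_mul_cexp_le {a w x : ℝ} (hw : 0 < w) (hx : x ∈ Icc 0 a) :
    ‖∫ t in (0 : ℝ)..x, (Real.log t : ℂ) * Complex.exp (Complex.I * w * t)‖
      ≤ (5 + 2 * |Real.log a|) * ((1 + |Real.log w|) * w⁻¹) := by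
  have hw' : 0 < w⁻¹ := inv_pos.2 hw
  have hlw := abs_nonneg (Real.log w)
  have hla := abs_nonneg (Real.log a)
  have hB : 0 ≤ (1 + |Real.log w|) * w⁻¹ := by positivity
  rcases hx.1.eq_or_lt with rfl | hx0
  · rw [intervalIntegral.integral_same, norm_zero]
    positivity
  rcases le_total x w⁻¹ with hxw | hxw
  · exact (norm_integral_log_mul_cexp_le_of_le hw hx0 hxw).trans (by nlinarith)
  · rw [← intervalIntegral.integral_add_adjacent_intervals
      (intervalIntegrable_log_mul_cexp w 0 w⁻¹) (intervalIntegrable_log_mul_cexp w w⁻¹ x)]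
    refine (norm_add_le _ _).trans ((add_le_add (norm_integral_log_mul_cexp_le_of_le hw hw' le_rfl)
      (norm_integral_log_mul_cexp_le_of_inv_le hw hxw)).trans ?_)
    have h1 : -Real.log w ≤ Real.log x := by
      rw [← Real.log_inv]
      exact Real.log_le_log hw' hxw
    have h2 : Real.log x ≤ Real.log a := Real.log_le_log hx0 hx.2
    have h3 : |Real.log x| ≤ |Real.log a| + |Real.log w| := by
      rw [abs_le]
      constructor <;> linarith [le_abs_self (Real.log a), le_abs_self (Real.log w)]
    rw [← add_mul, ← mul_assoc]
    refine mul_le_mul_of_nonneg_right ?_ hw'.le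
    nlinarith [mul_nonneg hla hlw]

/-- Integration by parts against a primitive of the kernel bounded by `B`. -/
theorem norm_integral_mul_log_mul_cexp_le {a w B D : ℝ} (ha : 0 < a)
    (hB : ∀ x ∈ Icc 0 a,
      ‖∫ t in (0 : ℝ)..x, (Real.log t : ℂ) * Complex.exp (Complex.I * w * t)‖ ≤ B)
    {g g' : ℝ → ℂ} (hg : ∀ x ∈ Icc 0 a, HasDerivWithinAt g (g' x) (Icc 0 a) x)
    (hg' : ContinuousOn g' (Icc 0 a)) (hD : ∀ x ∈ Icc 0 a, ‖g' x‖ ≤ D)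
    {x₀ : ℝ} (hx₀ : x₀ ∈ Icc 0 a) (h0 : g x₀ = 0) :
    ‖∫ x in Ioc 0 a, g x * (Real.log x : ℂ) * Complex.exp (Complex.I * w * x)‖
      ≤ 2 * B * (D * a) := by
  let v : ℝ → ℂ := fun x ↦
    ∫ t in (0 : ℝ)..x, (Real.log t : ℂ) * Complex.exp (Complex.I * w * t)
  have haa : a ∈ Icc 0 a := right_mem_Icc.2 ha.le
  have hB0 : 0 ≤ B := (norm_nonneg _).trans (hB a haa)
  have hD0 : 0 ≤ D := (norm_nonneg _).trans (hD a haa)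
  have hga : ‖g a‖ ≤ D * a := by
    have h := (convex_Icc 0 a).norm_image_sub_le_of_norm_hasDerivWithin_le hg hD hx₀ haa
    rw [h0, sub_zero] at h
    refine h.trans (mul_le_mul_of_nonneg_left ?_ hD0)
    rw [Real.norm_eq_abs, abs_le]
    constructor <;> linarith [hx₀.1, hx₀.2]
  have hv : ∀ x ∈ Ioo 0 a,
      HasDerivAt v ((Real.log x : ℂ) * Complex.exp (Complex.I * w * x)) x := fun x hx ↦ by
    have hmeas : StronglyMeasurable
        fun t : ℝ ↦ (Real.log t : ℂ) * Complex.exp (Complex.I * w * t) := by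
      apply Measurable.stronglyMeasurable
      fun_prop
    refine intervalIntegral.integral_hasDerivAt_right (intervalIntegrable_log_mul_cexp w 0 x)
      hmeas.stronglyMeasurableAtFilter ?_
    have := hx.1.ne'
    exact ((Complex.continuous_ofReal.continuousAt.comp (Real.continuousAt_log this)).mul
      (by fun_prop))
  have hvc : ContinuousOn v (Icc 0 a) := by
    rw [← uIcc_of_le ha.le]
    exact intervalIntegral.continuousOn_primitive_interval'
      (intervalIntegrable_log_mul_cexp w 0 a) left_mem_uIcc
  have hparts := intervalIntegral.integral_mul_deriv_eq_deriv_mul_of_hasDerivAt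
    (a := 0) (b := a) (u := g) (u' := g') (v := v)
    (by rw [uIcc_of_le ha.le]; exact fun x hx ↦ (hg x hx).continuousWithinAt)
    (by rwa [uIcc_of_le ha.le])
    (by
      rw [min_eq_left ha.le, max_eq_right ha.le]
      exact fun x hx ↦ (hg x (Ioo_subset_Icc_self hx)).hasDerivAt (Icc_mem_nhds hx.1 hx.2))
    (by rwa [min_eq_left ha.le, max_eq_right ha.le])
    (by
      rw [← uIcc_of_le ha.le] at hg'
      exact hg'.intervalIntegrable)
    (intervalIntegrable_log_mul_cexp w 0 a)
  rw [← intervalIntegral.integral_of_le ha.le]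
  simp only [mul_assoc _ (Complex.ofReal (Real.log _))] at hparts ⊢
  rw [hparts, show v 0 = 0 from intervalIntegral.integral_same, mul_zero, sub_zero]
  have h1 : ‖g a * v a‖ ≤ D * a * B := by
    rw [norm_mul]
    exact mul_le_mul hga (hB a haa) (norm_nonneg _) (by positivity)
  have h2 : ‖∫ x in (0 : ℝ)..a, g' x * v x‖ ≤ D * B * |a - 0| := by
    refine intervalIntegral.norm_integral_le_of_norm_le_const fun x hx ↦ ?_
    rw [uIoc_of_le ha.le] at hx
    have hx' := Ioc_subset_Icc_self hx
    rw [norm_mul]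
    exact mul_le_mul (hD x hx') (hB x hx') (norm_nonneg _) hD0
  rw [sub_zero, abs_of_pos ha] at h2
  linarith [norm_sub_le (g a * v a) (∫ x in (0 : ℝ)..a, g' x * v x)]

theorem hasDerivWithinAt_iteratedDerivWithin {E : Type*} [NormedAddCommGroup E]
    [NormedSpace ℝ E] {f : ℝ → E} {s : Set ℝ} (hs : UniqueDiffOn ℝ s) {n k : ℕ}
    (hf : ContDiffOn ℝ n f s) (hk : k < n) {x : ℝ} (hx : x ∈ s) :
    HasDerivWithinAt (iteratedDerivWithin k f s) (iteratedDerivWithin (k + 1) f s x) s x := by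
  rw [iteratedDerivWithin_succ]
  exact (hf.differentiableOn_iteratedDerivWithin (by exact_mod_cast hk) hs x hx).hasDerivWithinAt

theorem norm_le_biSup_of_continuousOn {E : Type*} [NormedAddCommGroup E] {f : ℝ → E} {s : Set ℝ}
    (hs : IsCompact s) (hf : ContinuousOn f s) {x : ℝ} (hx : x ∈ s) :
    ‖f x‖ ≤ ⨆ y ∈ s, ‖f y‖ := by
  obtain ⟨R, hR⟩ := hs.exists_bound_of_continuousOn hf
  have hR0 : 0 ≤ R := (norm_nonneg _).trans (hR x hx)
  have hbdd : BddAbove (range fun y ↦ ⨆ _ : y ∈ s, ‖f y‖) :=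
    ⟨R, by rintro _ ⟨y, rfl⟩; exact Real.iSup_le (hR y) hR0⟩
  refine le_trans ?_ (le_ciSup hbdd x)
  simp [hx]

/-- Theorem 2, first bound: there is `C = C(a) > 0` such that for every `n ≥ 2`,
`f ∈ Cⁿ([0,a],ℂ)`, distinct nodes in `[0,a]`, Lagrange interpolant `f̂` of `f` at the
nodes, and `w > 0`:
`E_n(f) = |∫_0^a (f - f̂) log x e^{iwx} dx| ≤ C (1+|log w|) w⁻¹ ‖f⁽ⁿ⁾‖_∞ aⁿ/(n-1)!`. -/
theorem stmt_11 (a : ℝ) (ha : 0 < a) :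
    ∃ C > 0, ∀ n : ℕ, 2 ≤ n →
      ∀ f : ℝ → ℂ, ContDiffOn ℝ n f (Icc 0 a) →
      ∀ xh : Fin n → ℝ, StrictMono xh → (∀ j, xh j ∈ Icc 0 a) →
      ∀ fhat : Polynomial ℂ, fhat.degree < (n : ℕ) →
        (∀ j : Fin n, fhat.eval ((xh j : ℝ) : ℂ) = f (xh j)) →
      ∀ w : ℝ, 0 < w →
      ‖∫ x in Ioc 0 a, (f x - fhat.eval ((x : ℝ) : ℂ)) * (Real.log x : ℂ)
          * Complex.exp (Complex.I * w * x)‖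
        ≤ C * (1 + |Real.log w|) * w⁻¹ *
            (⨆ x ∈ Icc 0 a, ‖iteratedDerivWithin n f (Icc 0 a) x‖) * a ^ n
            / (Nat.factorial (n - 1)) := by
  refine ⟨2 * (5 + 2 * |Real.log a|), by positivity, ?_⟩
  intro n hn f hf xh hxh hmem fhat hdeg hinterp w hw
  obtain ⟨m, rfl⟩ : ∃ m, n = m + 1 := ⟨n - 1, by lia⟩
  have hs : UniqueDiffOn ℝ (Icc 0 a) := uniqueDiffOn_Icc ha
  set M := ⨆ x ∈ Icc 0 a, ‖iteratedDerivWithin (m + 1) f (Icc 0 a) x‖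
  have hbound : ∀ x ∈ Icc 0 a, ‖iteratedDerivWithin (m + 1) f (Icc 0 a) x‖ ≤ M := fun x hx ↦
    norm_le_biSup_of_continuousOn isCompact_Icc
      (hf.continuousOn_iteratedDerivWithin le_rfl hs) hx
  have hM0 : 0 ≤ M := (norm_nonneg _).trans (hbound 0 (left_mem_Icc.2 ha.le))
  let G : ℕ → ℝ → ℂ := fun k x ↦
    iteratedDerivWithin k f (Icc 0 a) x - (derivative^[k] fhat).eval (x : ℂ)
  have hG : ∀ k < m + 1, ∀ x ∈ Icc 0 a,
      HasDerivWithinAt (G k) (G (k + 1) x) (Icc 0 a) x := fun k hk x hx ↦ by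
    have h := ((derivative^[k] fhat).hasDerivAt (x : ℂ)).comp_ofReal.hasDerivWithinAt
      (s := Icc 0 a)
    rw [← Function.iterate_succ_apply' derivative] at h
    exact (hasDerivWithinAt_iteratedDerivWithin hs hf hk hx).sub h
  have hGtop : ∀ x ∈ Icc 0 a, ‖G (m + 1) x‖ ≤ M := fun x hx ↦ by
    have h : derivative^[m + 1] fhat = 0 :=
      iterate_derivative_eq_zero_of_degree_lt hdeg
    simpa [G, h] using hbound x hx
  have hzero : ∀ j, G 0 (xh j) = 0 := fun j ↦ by simp [G, hinterp]
  have key := norm_integral_mul_log_mul_cexp_le ha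
    (fun x hx ↦ norm_integral_log_mul_cexp_le hw hx) (hG 0 (Nat.succ_pos m))
    (fun x hx ↦ (hG 1 (by lia) x hx).continuousWithinAt)
    (fun x hx ↦ norm_deriv_le_of_zeros_of_hasDerivWithinAt_chain hM0 hG hGtop hxh hmem hzero hx)
    (hmem 0) (hzero 0)
  simp only [G, iteratedDerivWithin_zero, Function.iterate_zero, id] at key
  refine key.trans_eq ?_
  rw [Nat.add_sub_cancel, pow_succ]
  ring
end

section
/- Let a > 0, let w ∈ ℝ, let g ∈ C^1([0,a], ℝ) satisfy g(0) = 0 and g'(x) > 0 for all x ∈ [0,a], and let f : [0,a] → ℂ be continuous. Let g^{-1} : [0, g(a)] → [0,a] denote the inverse of g. Then all three integrals below converge (as Lebesgue integrals over the punctured intervals) and ∫_0^a f(x)·log(x)·e^{iwg(x)} dx = ∫_0^a f(x)·log(x/g(x))·e^{iwg(x)} dx + ∫_0^{g(a)} ( f(g^{-1}(y)) / g'(g^{-1}(y)) ) · log(y) · e^{iwy} dy, where the function x ↦ log(x/g(x)) is extended to x = 0 by its limit value −log(g'(0)). -/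
open Set MeasureTheory

/-- The splitting of the singular oscillatory integral for a general oscillator `g`
(change of variables `y = g(x)`):
`∫_0^a f log x e^{iwg} dx = ∫_0^a f log(x/g(x)) e^{iwg} dx
  + ∫_0^{g(a)} (f∘g⁻¹/g'∘g⁻¹) log y e^{iwy} dy`, all three integrals converging. -/
theorem stmt_17 (a : ℝ) (ha : 0 < a) (w : ℝ)
    (g : ℝ → ℝ) (hg : ContDiffOn ℝ 1 g (Icc 0 a)) (hg0 : g 0 = 0)
    (hg' : ∀ x ∈ Icc 0 a, 0 < derivWithin g (Icc 0 a) x)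
    (f : ℝ → ℂ) (hf : ContinuousOn f (Icc 0 a))
    (ginv : ℝ → ℝ)
    (hginv : ∀ x ∈ Icc 0 a, ginv (g x) = x)
    (hginv' : ∀ y ∈ Icc 0 (g a), g (ginv y) = y) :
    IntegrableOn
      (fun x : ℝ => f x * (Real.log x : ℂ) * Complex.exp (Complex.I * w * g x))
      (Ioc 0 a) volume ∧
    IntegrableOn
      (fun x : ℝ => f x * (Real.log (x / g x) : ℂ) * Complex.exp (Complex.I * w * g x))
      (Ioc 0 a) volume ∧
    IntegrableOn
      (fun y : ℝ => (f (ginv y) / ((derivWithin g (Icc 0 a) (ginv y) : ℝ) : ℂ))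
        * (Real.log y : ℂ) * Complex.exp (Complex.I * w * y))
      (Ioc 0 (g a)) volume ∧
    ∫ x in Ioc 0 a, f x * (Real.log x : ℂ) * Complex.exp (Complex.I * w * g x)
      = (∫ x in Ioc 0 a,
          f x * (Real.log (x / g x) : ℂ) * Complex.exp (Complex.I * w * g x))
        + ∫ y in Ioc 0 (g a),
            (f (ginv y) / ((derivWithin g (Icc 0 a) (ginv y) : ℝ) : ℂ))
              * (Real.log y : ℂ) * Complex.exp (Complex.I * w * y) := by
  have hud : UniqueDiffOn ℝ (Icc 0 a) := uniqueDiffOn_Icc ha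
  have hsub : Ioc 0 a ⊆ Icc 0 a := Ioc_subset_Icc_self
  have hgc : ContinuousOn g (Icc 0 a) := hg.continuousOn
  have hdc : ContinuousOn (derivWithin g (Icc 0 a)) (Icc 0 a) :=
    hg.continuousOn_derivWithin hud le_rfl
  have hd : ∀ x ∈ Icc 0 a, HasDerivWithinAt g (derivWithin g (Icc 0 a) x) (Icc 0 a) x :=
    fun x hx => (hg.differentiableOn one_ne_zero x hx).hasDerivWithinAt
  have hmono : StrictMonoOn g (Icc 0 a) := by
    refine strictMonoOn_of_deriv_pos (convex_Icc 0 a) hgc fun x hx => ?_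
    have hx' := interior_subset hx
    rw [← derivWithin_of_mem_nhds (mem_interior_iff_mem_nhds.1 hx)]
    exact hg' x hx'
  have h0 : (0 : ℝ) ∈ Icc 0 a := ⟨le_rfl, ha.le⟩
  have h1 : a ∈ Icc 0 a := ⟨ha.le, le_rfl⟩
  have hpos : ∀ x ∈ Ioc 0 a, 0 < g x := fun x hx => hg0 ▸ hmono h0 (hsub hx) hx.1
  have himg : g '' Ioc 0 a = Ioc 0 (g a) := by
    apply Subset.antisymm
    · rintro _ ⟨x, hx, rfl⟩
      exact ⟨hpos x hx, hmono.monotoneOn (hsub hx) h1 hx.2⟩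
    · have h := intermediate_value_Ioc ha.le hgc
      rwa [hg0] at h
  have hinj : InjOn g (Ioc 0 a) := hmono.injOn.mono hsub
  have hdS : ∀ x ∈ Ioc 0 a,
      HasDerivWithinAt g (derivWithin g (Icc 0 a) x) (Ioc 0 a) x :=
    fun x hx => (hd x (hsub hx)).mono hsub
  have hlog : ∀ b : ℝ, 0 ≤ b → IntegrableOn Real.log (Ioc 0 b) := fun b hb =>
    (intervalIntegrable_iff_integrableOn_Ioc_of_le hb).1
      intervalIntegral.intervalIntegrable_log'
  have hmul : ∀ φ : ℝ → ℂ, ContinuousOn φ (Icc 0 a) → ∀ u : ℝ → ℂ,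
      IntegrableOn u (Ioc 0 a) → IntegrableOn (fun x => φ x * u x) (Ioc 0 a) :=
    fun φ hφ u hu => by
      rw [← integrableOn_Icc_iff_integrableOn_Ioc] at hu ⊢
      exact hu.continuousOn_mul hφ isCompact_Icc
  have hφ : ContinuousOn (fun x => f x * Complex.exp (Complex.I * w * g x)) (Icc 0 a) := by
    fun_prop
  have hlogg : IntegrableOn (fun x => (Real.log (g x) : ℂ)) (Ioc 0 a) := by
    have h := hlog (g a) (hpos a ⟨ha, le_rfl⟩).le
    rw [← himg, integrableOn_image_iff_integrableOn_abs_deriv_smul measurableSet_Ioc hdS hinj]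
      at h
    have hinv : ContinuousOn
        (fun x => (((derivWithin g (Icc 0 a) x)⁻¹ : ℝ) : ℂ)) (Icc 0 a) :=
      Complex.continuous_ofReal.comp_continuousOn (hdc.inv₀ fun x hx => (hg' x hx).ne')
    refine (hmul _ hinv _ h.ofReal).congr_fun (fun x hx => ?_) measurableSet_Ioc
    have hx' := hg' x (hsub hx)
    have hne : ((derivWithin g (Icc 0 a) x : ℝ) : ℂ) ≠ 0 := by exact_mod_cast hx'.ne'
    simp [abs_of_pos hx', hne]
  have I1 : IntegrableOn
      (fun x : ℝ => f x * (Real.log x : ℂ) * Complex.exp (Complex.I * w * g x)) (Ioc 0 a) := by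
    refine (hmul _ hφ _ (hlog a ha.le).ofReal).congr_fun (fun x _ => ?_) measurableSet_Ioc
    simp only [RCLike.ofReal_eq_complex_ofReal]
    ring
  have I4 : IntegrableOn
      (fun x : ℝ => f x * (Real.log (g x) : ℂ) * Complex.exp (Complex.I * w * g x))
      (Ioc 0 a) := by
    refine (hmul _ hφ _ hlogg).congr_fun (fun x _ => ?_) measurableSet_Ioc
    ring
  have hsplit : EqOn
      (fun x : ℝ => f x * (Real.log x : ℂ) * Complex.exp (Complex.I * w * g x)
        - f x * (Real.log (g x) : ℂ) * Complex.exp (Complex.I * w * g x))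
      (fun x : ℝ => f x * (Real.log (x / g x) : ℂ) * Complex.exp (Complex.I * w * g x))
      (Ioc 0 a) := fun x hx => by
    simp only [Real.log_div hx.1.ne' (hpos x hx).ne', Complex.ofReal_sub]
    ring
  have hcov : EqOn
      (fun x : ℝ => |derivWithin g (Icc 0 a) x| •
        ((f (ginv (g x)) / ((derivWithin g (Icc 0 a) (ginv (g x)) : ℝ) : ℂ))
          * (Real.log (g x) : ℂ) * Complex.exp (Complex.I * w * g x)))
      (fun x : ℝ => f x * (Real.log (g x) : ℂ) * Complex.exp (Complex.I * w * g x))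
      (Ioc 0 a) := fun x hx => by
    have hx' := hg' x (hsub hx)
    have hne : ((derivWithin g (Icc 0 a) x : ℝ) : ℂ) ≠ 0 := by exact_mod_cast hx'.ne'
    simp only [hginv x (hsub hx), abs_of_pos hx', Complex.real_smul]
    field_simp
  refine ⟨I1, (I1.sub I4).congr_fun hsplit measurableSet_Ioc, ?_, ?_⟩
  · rw [← himg, integrableOn_image_iff_integrableOn_abs_deriv_smul measurableSet_Ioc hdS hinj]
    exact I4.congr_fun hcov.symm measurableSet_Ioc
  · rw [← himg, integral_image_eq_integral_abs_deriv_smul measurableSet_Ioc hdS hinj,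
      setIntegral_congr_fun measurableSet_Ioc hcov,
      ← setIntegral_congr_fun measurableSet_Ioc hsplit, integral_sub I1 I4, sub_add_cancel]
end
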